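/- arXiv:2411.05464 — 2 statements merged into one kernel-verified Lean document; each statement's English description precedes it below -/
import Mathlib

section
/- For every L ∈ ℕ, the set N¹_L = { h(φ)^(L) : H^L → ℝ | φ is an L-layer MPNN model } of MPNN feature maps on order-L iterated degree measures is closed under multiplication and linear combinations, contains the constant function 1, and separates points of H^L; consequently, by the Stone–Weierstrass theorem, N¹_L is uniformly dense in C(H^L, ℝ). -/
open MeasureTheory
open scoped ENNReal NNReal

/-- Unbalanced optimal transport distance (real valued) with ground cost `d`. -/
noncomputable def UOTr {α : Type*} [MeasurableSpace α] (d : α → α → ℝ) (μ ν : Measure α) : ℝ :=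
  (if μ Set.univ ≤ ν Set.univ then
      sInf {c : ℝ | ∃ γ : Measure (α × α),
        γ.map Prod.fst = μ ∧ γ.map Prod.snd ≤ ν ∧ c = ∫ q, d q.1 q.2 ∂γ}
    else
      sInf {c : ℝ | ∃ γ : Measure (α × α),
        γ.map Prod.fst = ν ∧ γ.map Prod.snd ≤ μ ∧ c = ∫ q, d q.1 q.2 ∂γ})
  + |(μ Set.univ).toReal - (ν Set.univ).toReal|

/-- One step of the iterated degree measure construction: from `(H^t, d_IDM^t)` produce
`(H^{t+1}, d_IDM^{t+1})` where `H^{t+1} = H^t × M_{≤1}(H^t)` (weak* topology on measures)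
and the distance is the sum of the lower-level distance and unbalanced optimal transport. -/
noncomputable def IDMstep :
    (Σ H : Type, TopologicalSpace H × (H → H → ℝ)) →
    Σ H : Type, TopologicalSpace H × (H → H → ℝ) := fun prev =>
  letI : TopologicalSpace prev.1 := prev.2.1
  letI : MeasurableSpace prev.1 := borel prev.1
  haveI : BorelSpace prev.1 := ⟨rfl⟩
  ⟨prev.1 × {μ : FiniteMeasure prev.1 // (μ : Measure prev.1) Set.univ ≤ 1},
    inferInstance,
    fun x y => prev.2.2 x.1 y.1 +
      UOTr prev.2.2 (x.2.1 : Measure prev.1) (y.2.1 : Measure prev.1)⟩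

/-- The iterated degree measure spaces: `H^0` is the closed ball of radius `r` in `ℝ^p`
with the euclidean metric, and `H^{t+1} = H^t × M_{≤1}(H^t)`. -/
noncomputable def IDMaux (p : ℕ) (r : ℝ) : ℕ → Σ H : Type, TopologicalSpace H × (H → H → ℝ)
  | 0 => ⟨Metric.closedBall (0 : EuclideanSpace ℝ (Fin p)) r, inferInstance,
          fun x y => dist x y⟩
  | t + 1 => IDMstep (IDMaux p r t)

/-- The space `H^t` of order-`t` iterated degree measures. -/
noncomputable def Hty (p : ℕ) (r : ℝ) (t : ℕ) : Type := (IDMaux p r t).1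

noncomputable instance (p : ℕ) (r : ℝ) (t : ℕ) : TopologicalSpace (Hty p r t) :=
  (IDMaux p r t).2.1

noncomputable instance (p : ℕ) (r : ℝ) (t : ℕ) : MeasurableSpace (Hty p r t) :=
  borel (Hty p r t)

instance (p : ℕ) (r : ℝ) (t : ℕ) : BorelSpace (Hty p r t) := ⟨rfl⟩

/-- The IDM metric `d_IDM^t` on `H^t`. -/
noncomputable def dIDM (p : ℕ) (r : ℝ) (t : ℕ) : Hty p r t → Hty p r t → ℝ :=
  (IDMaux p r t).2.2

/-- The space `M^{t+1} = M_{≤1}(H^t)` of sub-probability measures on `H^t`. -/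
noncomputable def Mty (p : ℕ) (r : ℝ) (t : ℕ) : Type :=
  {μ : FiniteMeasure (Hty p r t) // (μ : Measure (Hty p r t)) Set.univ ≤ 1}

/-- `H^{t+1}` is (definitionally) `H^t × M^{t+1}`. -/
noncomputable def toProd (p : ℕ) (r : ℝ) (t : ℕ) :
    Hty p r (t + 1) → Hty p r t × Mty p r t := fun τ => τ

/-- `H^0` is (definitionally) the closed ball of radius `r` in `ℝ^p`. -/
noncomputable def toBall (p : ℕ) (r : ℝ) : Hty p r 0 → EuclideanSpace ℝ (Fin p) :=
  fun τ => (show (Metric.closedBall (0 : EuclideanSpace ℝ (Fin p)) r : Set _) from ↑τ)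

/-- The canonical projection `p_{t+1,t} : H^{t+1} → H^t`. -/
noncomputable def projH (p : ℕ) (r : ℝ) (t : ℕ) : Hty p r (t + 1) → Hty p r t :=
  fun τ => (toProd p r t τ).1

/-- The canonical projection `p_{t+1} : H^{t+1} → M^{t+1}`, as a measure on `H^t`. -/
noncomputable def measOf (p : ℕ) (r : ℝ) (t : ℕ) (τ : Hty p r (t + 1)) :
    Measure (Hty p r t) := ((toProd p r t τ).2.1 : Measure (Hty p r t))

/-- An MPNN model: a sequence of Lipschitz update functions `φ^(t)`, where
`φ^(0) : ℝ^p → ℝ^{d_0}` and `φ^(t+1) : ℝ^{d_t} × ℝ^{d_t} → ℝ^{d_{t+1}}`. -/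
structure MPNN (p : ℕ) where
  dims : ℕ → ℕ
  K0 : ℝ≥0
  Ks : ℕ → ℝ≥0
  φ0 : EuclideanSpace ℝ (Fin p) → EuclideanSpace ℝ (Fin (dims 0))
  φ : (t : ℕ) → EuclideanSpace ℝ (Fin (dims t)) × EuclideanSpace ℝ (Fin (dims t)) →
        EuclideanSpace ℝ (Fin (dims (t + 1)))
  lip0 : LipschitzWith K0 φ0
  lip : ∀ t, LipschitzWith (Ks t) (φ t)

/-- The IDM feature maps `h^{(t)} : H^t → ℝ^{d_t}` of an MPNN model:
`h^{(0)}_τ = φ^{(0)}(τ)` and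
`h^{(t+1)}_τ = φ^{(t+1)}(h^{(t)}_{p_{t+1,t}(τ)}, ∫_{H^t} h^{(t)} d p_{t+1}(τ))`. -/
noncomputable def feat (p : ℕ) (r : ℝ) (Φ : MPNN p) :
    (t : ℕ) → Hty p r t → EuclideanSpace ℝ (Fin (Φ.dims t))
  | 0 => fun τ => Φ.φ0 (toBall p r τ)
  | t + 1 => fun τ =>
      Φ.φ t (feat p r Φ t (projH p r t τ), ∫ x, feat p r Φ t x ∂(measOf p r t τ))

/-- The set `N¹_L` of scalar-valued MPNN feature maps on `H^L`: functions of the form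
`τ ↦ h(φ)^{(L)}_τ` for an `L`-layer MPNN model `φ` with output feature dimension one. -/
noncomputable def NL (p : ℕ) (r : ℝ) (L : ℕ) : Set (Hty p r L → ℝ) :=
  {f | ∃ Φ : MPNN p, Φ.dims L = 1 ∧ ∀ τ, f τ = ∑ i, feat p r Φ L τ i}


/-- Sub-probability measures on a compact metrizable space form a compact metrizable space. -/
theorem subprob_compact_metrizable (X : Type) [TopologicalSpace X] [CompactSpace X]
    [TopologicalSpace.MetrizableSpace X] [MeasurableSpace X] [BorelSpace X] :
    CompactSpace {μ : FiniteMeasure X // (μ : Measure X) Set.univ ≤ 1} ∧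
    TopologicalSpace.MetrizableSpace {μ : FiniteMeasure X // (μ : Measure X) Set.univ ≤ 1} := by
  have hc : CompactSpace {μ : FiniteMeasure X // (μ : Measure X) Set.univ ≤ 1} := by
    have h := isCompact_setOfPred_finiteMeasure_le_of_compactSpace X 1
    have h2 : {μ : FiniteMeasure X | μ.mass ≤ 1} =
        {μ : FiniteMeasure X | (μ : Measure X) Set.univ ≤ 1} := by
      ext μ
      simp only [Set.mem_ofPred_eq]
      rw [← FiniteMeasure.ennreal_mass]
      exact_mod_cast Iff.rfl
    rw [h2] at h
    exact isCompact_iff_compactSpace.mp h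
  refine ⟨hc, ?_⟩
  letI := TopologicalSpace.metrizableSpaceMetric X
  let D := TopologicalSpace.denseSeq C(X, ℝ)
  refine Metric.PiNatEmbed.TopologicalSpace.MetrizableSpace.of_countable_separating
    (Y := fun _ : ℕ => ℝ)
    (fun i μ => ∫ x, D i x ∂(μ.1 : Measure X)) ?_ ?_
  · intro i
    exact (FiniteMeasure.continuous_integral_continuousMap (D i)).comp continuous_subtype_val
  · intro μ ν hne
    by_contra hcon
    push Not at hcon
    apply hne
    suffices key : (μ.1 : Measure X) = (ν.1 : Measure X) from Subtype.ext (Subtype.ext key)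
    apply ext_of_forall_integral_eq_of_IsFiniteMeasure
    intro f
    have hcont : ∀ ρ : FiniteMeasure X,
        Continuous (fun F : C(X, ℝ) => ∫ x, F x ∂(ρ : Measure X)) := by
      intro ρ
      have : LipschitzWith (ρ.mass) (fun F : C(X, ℝ) => ∫ x, F x ∂(ρ : Measure X)) := by
        refine LipschitzWith.of_dist_le_mul fun F G => ?_
        have hi : ∀ F : C(X, ℝ), Integrable (fun x => F x) (ρ : Measure X) := fun F =>
          F.continuous.integrable_of_hasCompactSupport (HasCompactSupport.of_compactSpace _)
        rw [dist_eq_norm, ← integral_sub (hi F) (hi G), mul_comm]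
        refine norm_integral_le_of_norm_le_const (Filter.Eventually.of_forall fun x => ?_)
        rw [← dist_eq_norm]
        exact ContinuousMap.dist_apply_le_dist x
      exact this.continuous
    have heq : (fun F : C(X, ℝ) => ∫ x, F x ∂(μ.1 : Measure X)) =
        (fun F : C(X, ℝ) => ∫ x, F x ∂(ν.1 : Measure X)) := by
      refine Continuous.ext_on (TopologicalSpace.denseRange_denseSeq C(X, ℝ))
        (hcont μ.1) (hcont ν.1) ?_
      rintro _ ⟨i, rfl⟩
      exact hcon i
    exact congrFun heq f.toContinuousMap

theorem Hty_top (p : ℕ) (r : ℝ) (t : ℕ) :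
    CompactSpace (Hty p r t) ∧ TopologicalSpace.MetrizableSpace (Hty p r t) := by
  induction t with
  | zero =>
    constructor
    · change CompactSpace (Metric.closedBall (0 : EuclideanSpace ℝ (Fin p)) r)
      infer_instance
    · change TopologicalSpace.MetrizableSpace (Metric.closedBall (0 : EuclideanSpace ℝ (Fin p)) r)
      infer_instance
  | succ t ih =>
    obtain ⟨h1, h2⟩ := ih
    obtain ⟨h3, h4⟩ := subprob_compact_metrizable (Hty p r t)
    constructor
    · change CompactSpace (Hty p r t ×
        {μ : FiniteMeasure (Hty p r t) // (μ : Measure (Hty p r t)) Set.univ ≤ 1})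
      infer_instance
    · change TopologicalSpace.MetrizableSpace (Hty p r t ×
        {μ : FiniteMeasure (Hty p r t) // (μ : Measure (Hty p r t)) Set.univ ≤ 1})
      infer_instance

instance Hty_compact (p : ℕ) (r : ℝ) (t : ℕ) : CompactSpace (Hty p r t) := (Hty_top p r t).1
instance Hty_metr (p : ℕ) (r : ℝ) (t : ℕ) : TopologicalSpace.MetrizableSpace (Hty p r t) :=
  (Hty_top p r t).2

/-- Recursive description of (vector valued) features. -/
def IsFeat (p : ℕ) (r : ℝ) : (t n : ℕ) → (Hty p r t → EuclideanSpace ℝ (Fin n)) → Prop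
  | 0, n, f => ∃ (K : ℝ≥0) (φ : EuclideanSpace ℝ (Fin p) → EuclideanSpace ℝ (Fin n)),
      LipschitzWith K φ ∧ f = fun τ => φ (toBall p r τ)
  | t + 1, n, f => ∃ (m : ℕ) (g : Hty p r t → EuclideanSpace ℝ (Fin m)), IsFeat p r t m g ∧
      ∃ (K : ℝ≥0) (φ : EuclideanSpace ℝ (Fin m) × EuclideanSpace ℝ (Fin m) →
        EuclideanSpace ℝ (Fin n)), LipschitzWith K φ ∧
        f = fun τ => φ (g (projH p r t τ), ∫ x, g x ∂(measOf p r t τ))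

instance measOf_fin (p : ℕ) (r : ℝ) (t : ℕ) (τ : Hty p r (t + 1)) :
    IsFiniteMeasure (measOf p r t τ) := by
  unfold measOf; infer_instance

theorem continuous_projH (p : ℕ) (r : ℝ) (t : ℕ) : Continuous (projH p r t) := by
  have : Continuous (Prod.fst : Hty p r t ×
        {μ : FiniteMeasure (Hty p r t) // (μ : Measure (Hty p r t)) Set.univ ≤ 1} → _) :=
    continuous_fst
  exact this

theorem continuous_integral_measOf (p : ℕ) (r : ℝ) (t : ℕ) (F : C(Hty p r t, ℝ)) :
    Continuous (fun τ => ∫ x, F x ∂(measOf p r t τ)) := by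
  have : Continuous (fun τ : Hty p r t ×
        {μ : FiniteMeasure (Hty p r t) // (μ : Measure (Hty p r t)) Set.univ ≤ 1} =>
        ∫ x, F x ∂(τ.2.1 : Measure (Hty p r t))) :=
    (FiniteMeasure.continuous_integral_continuousMap F).comp
      (continuous_subtype_val.comp continuous_snd)
  exact this

theorem Hty_integrable {p : ℕ} {r : ℝ} {t n : ℕ} {f : Hty p r t → EuclideanSpace ℝ (Fin n)}
    (hf : Continuous f) (μ : Measure (Hty p r t)) [IsFiniteMeasure μ] : Integrable f μ :=
  hf.integrable_of_hasCompactSupport (HasCompactSupport.of_compactSpace _)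

theorem IsFeat.continuous {p : ℕ} {r : ℝ} {t n : ℕ} {f : Hty p r t → EuclideanSpace ℝ (Fin n)}
    (hf : IsFeat p r t n f) : Continuous f := by
  induction t generalizing n with
  | zero =>
    obtain ⟨K, φ, hφ, rfl⟩ := hf
    refine hφ.continuous.comp ?_
    exact (continuous_subtype_val : Continuous
      (Subtype.val : Metric.closedBall (0 : EuclideanSpace ℝ (Fin p)) r → _))
  | succ t ih =>
    obtain ⟨m, g, hg, K, φ, hφ, rfl⟩ := hf
    have hgc := ih hg
    refine hφ.continuous.comp ((hgc.comp (continuous_projH p r t)).prodMk ?_)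
    rw [← (EuclideanSpace.equiv (Fin m) ℝ).toHomeomorph.comp_continuous_iff]
    refine continuous_pi fun i => ?_
    have h1 : Continuous fun x => g x i := by fun_prop
    have := continuous_integral_measOf p r t ⟨fun x => g x i, h1⟩
    convert this using 2 with τ
    exact ((EuclideanSpace.proj (𝕜 := ℝ) i).integral_comp_comm
      (Hty_integrable hgc (measOf p r t τ))).symm

theorem IsFeat.comp {p : ℕ} {r : ℝ} {t n k : ℕ} {f : Hty p r t → EuclideanSpace ℝ (Fin n)}
    (hf : IsFeat p r t n f) {K : ℝ≥0} {ψ : EuclideanSpace ℝ (Fin n) → EuclideanSpace ℝ (Fin k)}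
    (hψ : LipschitzWith K ψ) : IsFeat p r t k (fun τ => ψ (f τ)) := by
  cases t with
  | zero =>
    obtain ⟨K', φ, hφ, rfl⟩ := hf
    exact ⟨_, _, hψ.comp hφ, rfl⟩
  | succ t =>
    obtain ⟨m, g, hg, K', φ, hφ, rfl⟩ := hf
    exact ⟨m, g, hg, _, _, hψ.comp hφ, rfl⟩

theorem IsFeat.const {p : ℕ} {r : ℝ} (t : ℕ) {n : ℕ} (c : EuclideanSpace ℝ (Fin n)) :
    IsFeat p r t n (fun _ => c) := by
  induction t generalizing n with
  | zero => exact ⟨0, fun _ => c, LipschitzWith.const c, rfl⟩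
  | succ t ih => exact ⟨n, _, ih c, 0, fun _ => c, LipschitzWith.const c, rfl⟩

/-- Splitting a Euclidean space. -/
noncomputable def splitE (m n : ℕ) : EuclideanSpace ℝ (Fin (m + n)) ≃L[ℝ]
    EuclideanSpace ℝ (Fin m) × EuclideanSpace ℝ (Fin n) :=
  ContinuousLinearEquiv.ofFinrankEq (by simp)

theorem IsFeat.pair {p : ℕ} {r : ℝ} {t m n : ℕ} {f : Hty p r t → EuclideanSpace ℝ (Fin m)}
    {g : Hty p r t → EuclideanSpace ℝ (Fin n)}
    (hf : IsFeat p r t m f) (hg : IsFeat p r t n g) :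
    IsFeat p r t (m + n) (fun τ => (splitE m n).symm (f τ, g τ)) := by
  induction t generalizing m n with
  | zero =>
    obtain ⟨K, φ, hφ, rfl⟩ := hf
    obtain ⟨K', φ', hφ', rfl⟩ := hg
    exact ⟨_, fun x => (splitE m n).symm (φ x, φ' x),
      (splitE m n).symm.lipschitz.comp (hφ.prodMk hφ'), rfl⟩
  | succ t ih =>
    obtain ⟨a, u, hu, K, φ, hφ, rfl⟩ := hf
    obtain ⟨b, v, hv, K', φ', hφ', rfl⟩ := hg
    have huv := ih hu hv
    have hs := (splitE a b).lipschitz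
    have h1 := (LipschitzWith.prod_fst.comp hs)
    have h2 := (LipschitzWith.prod_snd.comp hs)
    refine ⟨a + b, _, huv, _, fun z => (splitE m n).symm
      (φ ((splitE a b z.1).1, (splitE a b z.2).1), φ' ((splitE a b z.1).2, (splitE a b z.2).2)),
      (splitE m n).symm.lipschitz.comp
        ((hφ.comp ((h1.comp LipschitzWith.prod_fst).prodMk (h1.comp LipschitzWith.prod_snd))).prodMk
        (hφ'.comp ((h2.comp LipschitzWith.prod_fst).prodMk (h2.comp LipschitzWith.prod_snd)))), ?_⟩
    funext τ
    have hi := Hty_integrable huv.continuous (measOf p r t τ)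
    have e1 := (((ContinuousLinearMap.fst ℝ (EuclideanSpace ℝ (Fin a))
      (EuclideanSpace ℝ (Fin b))).comp (splitE a b : _ →L[ℝ] _))).integral_comp_comm hi
    have e2 := (((ContinuousLinearMap.snd ℝ (EuclideanSpace ℝ (Fin a))
      (EuclideanSpace ℝ (Fin b))).comp (splitE a b : _ →L[ℝ] _))).integral_comp_comm hi
    simp at e1 e2
    simp [e1, e2]

/-- Casting between Euclidean spaces of equal dimension. -/
def castE {a b : ℕ} (h : a = b) (x : EuclideanSpace ℝ (Fin a)) : EuclideanSpace ℝ (Fin b) := h ▸ x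

theorem castE_rfl {a : ℕ} (h : a = a) (x : EuclideanSpace ℝ (Fin a)) : castE h x = x := rfl

theorem castE_castE {a b c : ℕ} (h : a = b) (h' : b = c) (x : EuclideanSpace ℝ (Fin a)) :
    castE h' (castE h x) = castE (h.trans h') x := by subst h; subst h'; rfl

theorem castE_lip {a b : ℕ} (h : a = b) : LipschitzWith 1 (castE h) := by
  subst h; exact LipschitzWith.id

theorem castE_integral {X : Type*} [MeasurableSpace X] (μ : Measure X) {a b : ℕ} (h : a = b)
    (f : X → EuclideanSpace ℝ (Fin a)) : ∫ x, castE h (f x) ∂μ = castE h (∫ x, f x ∂μ) := by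
  subst h; rfl

theorem castE_sum {a b : ℕ} (h : a = b) (x : EuclideanSpace ℝ (Fin a)) :
    ∑ i, castE h x i = ∑ i, x i := by subst h; rfl

theorem castLip1 {X : Type*} [PseudoEMetricSpace X] {a b : ℕ} (h : a = b) {K : ℝ≥0}
    {φ : X → EuclideanSpace ℝ (Fin a)} (hφ : LipschitzWith K φ) :
    LipschitzWith K (fun x => castE h (φ x)) := by subst h; exact hφ

theorem castLip2 {a b c d : ℕ} (h : a = b) (h1 : c = d) (h2 : c = d) {K : ℝ≥0}
    {φ : EuclideanSpace ℝ (Fin d) × EuclideanSpace ℝ (Fin d) → EuclideanSpace ℝ (Fin a)}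
    (hφ : LipschitzWith K φ) :
    LipschitzWith K (fun z : EuclideanSpace ℝ (Fin c) × EuclideanSpace ℝ (Fin c) =>
      castE h (φ (castE h1 z.1, castE h2 z.2))) := by subst h; subst h1; exact hφ

theorem isFeat_feat (p : ℕ) (r : ℝ) (Φ : MPNN p) (t : ℕ) :
    IsFeat p r t (Φ.dims t) (feat p r Φ t) := by
  induction t with
  | zero => exact ⟨_, _, Φ.lip0, rfl⟩
  | succ t ih => exact ⟨_, _, ih, _, _, Φ.lip t, rfl⟩

theorem IsFeat.castF {p : ℕ} {r : ℝ} {t n k : ℕ} {f : Hty p r t → EuclideanSpace ℝ (Fin n)}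
    (hf : IsFeat p r t n f) (h : n = k) : IsFeat p r t k (fun τ => castE h (f τ)) :=
  hf.comp (castE_lip h)

/-- Replace the layers of a model after layer `t`. -/
noncomputable def extendModel {p : ℕ} (Φ : MPNN p) (t n : ℕ) {K : ℝ≥0}
    (φ : EuclideanSpace ℝ (Fin (Φ.dims t)) × EuclideanSpace ℝ (Fin (Φ.dims t)) →
      EuclideanSpace ℝ (Fin n)) (hφ : LipschitzWith K φ) (D : ℕ → ℕ)
    (hD : ∀ s, s ≤ t → Φ.dims s = D s) (hn : n = D (t + 1)) : MPNN p where
  dims := D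
  K0 := Φ.K0
  Ks s := if s < t then Φ.Ks s else if s = t then K else 0
  φ0 x := castE (hD 0 (Nat.zero_le t)) (Φ.φ0 x)
  φ s := if h : s < t then
      fun z => castE (hD (s + 1) h)
        (Φ.φ s (castE (hD s h.le).symm z.1, castE (hD s h.le).symm z.2))
    else if h' : s = t then
      fun z => castE (hn.trans (by rw [h']))
        (φ (castE ((hD t le_rfl).trans (by rw [h'])).symm z.1,
          castE ((hD t le_rfl).trans (by rw [h'])).symm z.2))
    else fun _ => 0
  lip0 := castLip1 (hD 0 (Nat.zero_le t)) Φ.lip0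
  lip s := by
    by_cases h : s < t
    · rw [dif_pos h, if_pos h]
      exact castLip2 (hD (s + 1) h) (hD s h.le).symm (hD s h.le).symm (Φ.lip s)
    · rw [dif_neg h, if_neg h]
      by_cases h' : s = t
      · subst h'
        rw [dif_pos rfl, if_pos rfl]
        exact castLip2 hn (hD s le_rfl).symm (hD s le_rfl).symm hφ
      · rw [dif_neg h', if_neg h']
        exact LipschitzWith.const 0

theorem feat_extendModel {p : ℕ} {r : ℝ} (Φ : MPNN p) (t n : ℕ) {K : ℝ≥0}
    (φ : EuclideanSpace ℝ (Fin (Φ.dims t)) × EuclideanSpace ℝ (Fin (Φ.dims t)) →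
      EuclideanSpace ℝ (Fin n)) (hφ : LipschitzWith K φ) (D : ℕ → ℕ)
    (hD : ∀ s, s ≤ t → Φ.dims s = D s) (hn : n = D (t + 1)) (s : ℕ) (hs : s ≤ t) :
    feat p r (extendModel Φ t n φ hφ D hD hn) s = fun τ => castE (hD s hs) (feat p r Φ s τ) := by
  induction s with
  | zero => rfl
  | succ s ih =>
    have ih' := ih (by omega)
    funext τ
    have e : (extendModel Φ t n φ hφ D hD hn).φ s = fun z => castE (hD (s + 1) hs)
        (Φ.φ s (castE (hD s (by omega)).symm z.1, castE (hD s (by omega)).symm z.2)) :=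
      dif_pos (by omega)
    simp only [feat]
    rw [e, ih']
    erw [castE_integral]
    simp only [castE_castE, castE_rfl]
    rfl

theorem IsFeat.exists_model {p : ℕ} {r : ℝ} {t n : ℕ} {f : Hty p r t → EuclideanSpace ℝ (Fin n)}
    (hf : IsFeat p r t n f) :
    ∃ (Φ : MPNN p) (h : Φ.dims t = n), f = fun τ => _root_.castE h (feat p r Φ t τ) := by
  induction t generalizing n with
  | zero =>
    obtain ⟨K, φ, hφ, rfl⟩ := hf
    exact ⟨⟨fun _ => n, K, fun _ => 0, φ, fun _ _ => 0, hφ, fun _ => LipschitzWith.const 0⟩,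
      rfl, rfl⟩
  | succ t ih =>
    obtain ⟨m, g, hg, K, φ, hφ, rfl⟩ := hf
    obtain ⟨Φ, h, rfl⟩ := ih hg
    subst h
    obtain ⟨D, hD, hn⟩ : ∃ D : ℕ → ℕ, (∀ s, s ≤ t → Φ.dims s = D s) ∧ n = D (t + 1) :=
      ⟨fun s => if s ≤ t then Φ.dims s else n, fun s hs => by simp [hs], by simp⟩
    refine ⟨extendModel Φ t n φ hφ D hD hn, hn.symm, ?_⟩
    have e : (extendModel Φ t n φ hφ D hD hn).φ t = fun z => castE hn
        (φ (castE (hD t le_rfl).symm z.1, castE (hD t le_rfl).symm z.2)) :=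
      (dif_neg (lt_irrefl t)).trans (dif_pos rfl)
    funext τ
    simp only [feat]
    rw [e, feat_extendModel Φ t n φ hφ D hD hn t le_rfl]
    simp only [castE_rfl]
    erw [castE_integral, castE_castE]
    simp only [castE_castE, castE_rfl]

/-- Embedding of the reals in the one dimensional Euclidean space. -/
noncomputable def vec1 (c : ℝ) : EuclideanSpace ℝ (Fin 1) := WithLp.toLp 2 (fun _ => c)

theorem vec1_lip : LipschitzWith 1 vec1 := by
  refine LipschitzWith.of_dist_le_mul fun x y => ?_
  simp [vec1, EuclideanSpace.dist_eq, Real.sqrt_sq_eq_abs]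

theorem mem_NL_iff {p : ℕ} {r : ℝ} {L : ℕ} {f : Hty p r L → ℝ} :
    f ∈ NL p r L ↔ IsFeat p r L 1 (fun τ => vec1 (f τ)) := by
  constructor
  · rintro ⟨Φ, hd, hf⟩
    have := (isFeat_feat p r Φ L).castF hd
    convert this using 2 with τ
    rw [hf, ← castE_sum hd]
    ext i
    fin_cases i
    simp [vec1]
  · intro h
    obtain ⟨Φ, hd, hf⟩ := h.exists_model
    refine ⟨Φ, hd, fun τ => ?_⟩
    rw [← castE_sum hd, ← congrFun hf τ]
    simp [vec1]

theorem coord_lip {m : ℕ} (i : Fin m) :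
    LipschitzWith 1 (fun x : EuclideanSpace ℝ (Fin m) => x i) := by
  refine LipschitzWith.of_dist_le_mul fun x y => ?_
  have := PiLp.norm_apply_le (x - y) i
  simpa [dist_eq_norm] using this

theorem NL_continuous {p : ℕ} {r : ℝ} {L : ℕ} {f : Hty p r L → ℝ} (hf : f ∈ NL p r L) :
    Continuous f := by
  have := (mem_NL_iff.1 hf).continuous
  exact (coord_lip 0).continuous.comp this

theorem NL_comp2 {p : ℕ} {r : ℝ} {L : ℕ} {f g : Hty p r L → ℝ} (hf : f ∈ NL p r L)
    (hg : g ∈ NL p r L) {K : ℝ≥0} {ψ : ℝ × ℝ → ℝ} (hψ : LipschitzWith K ψ) :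
    (fun τ => ψ (f τ, g τ)) ∈ NL p r L := by
  rw [mem_NL_iff] at *
  have hs := (splitE 1 1).lipschitz
  have h1 := (coord_lip (m := 1) 0).comp (LipschitzWith.prod_fst.comp hs)
  have h2 := (coord_lip (m := 1) 0).comp (LipschitzWith.prod_snd.comp hs)
  have := (hf.pair hg).comp (vec1_lip.comp (hψ.comp (h1.prodMk h2)))
  convert this using 2 with τ
  simp [vec1]

theorem NL_mul {p : ℕ} {r : ℝ} {L : ℕ} {f g : Hty p r L → ℝ} (hf : f ∈ NL p r L)
    (hg : g ∈ NL p r L) : (fun τ => f τ * g τ) ∈ NL p r L := by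
  have hb : ∀ f : Hty p r L → ℝ, Continuous f → ∃ C : ℝ, 0 ≤ C ∧ ∀ τ, |f τ| ≤ C := by
    intro f hf
    exact ⟨‖(⟨f, hf⟩ : C(Hty p r L, ℝ))‖, norm_nonneg _, fun τ =>
      ContinuousMap.norm_coe_le_norm (⟨f, hf⟩ : C(Hty p r L, ℝ)) τ⟩
  obtain ⟨A, hA, hfA⟩ := hb f (NL_continuous hf)
  obtain ⟨B, hB, hgB⟩ := hb g (NL_continuous hg)
  have hl : LipschitzOnWith (Real.toNNReal (A + B)) (fun z : ℝ × ℝ => z.1 * z.2)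
      {z | |z.1| ≤ A ∧ |z.2| ≤ B} := by
    refine LipschitzOnWith.of_dist_le_mul fun x hx y hy => ?_
    rw [Real.coe_toNNReal _ (by positivity), Real.dist_eq]
    have e : x.1 * x.2 - y.1 * y.2 = x.1 * (x.2 - y.2) + (x.1 - y.1) * y.2 := by ring
    have d1 : |x.1 - y.1| ≤ dist x y := by
      rw [← Real.dist_eq]; exact le_max_left _ _
    have d2 : |x.2 - y.2| ≤ dist x y := by
      rw [← Real.dist_eq]; exact le_max_right _ _
    rw [e]
    refine (abs_add_le _ _).trans ?_
    rw [abs_mul, abs_mul, add_mul, mul_comm |x.1 - y.1|]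
    gcongr
    · exact hx.1
    · exact hy.2
  obtain ⟨ψ, hψ, he⟩ := hl.extend_real
  have := NL_comp2 hf hg hψ
  convert this using 2 with τ
  exact he (x := (f τ, g τ)) ⟨hfA τ, hgB τ⟩

theorem NL_lin {p : ℕ} {r : ℝ} {L : ℕ} {f g : Hty p r L → ℝ} (hf : f ∈ NL p r L)
    (hg : g ∈ NL p r L) (a b : ℝ) : (fun τ => a * f τ + b * g τ) ∈ NL p r L :=
  NL_comp2 hf hg (a • ContinuousLinearMap.fst ℝ ℝ ℝ + b • ContinuousLinearMap.snd ℝ ℝ ℝ).lipschitz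

theorem NL_const {p : ℕ} {r : ℝ} {L : ℕ} (c : ℝ) : (fun _ => c) ∈ NL p r L :=
  mem_NL_iff.2 (IsFeat.const L _)

/-- The features as a subalgebra of the continuous functions. -/
def NLalg (p : ℕ) (r : ℝ) (L : ℕ) : Subalgebra ℝ C(Hty p r L, ℝ) where
  carrier := {F | (F : Hty p r L → ℝ) ∈ NL p r L}
  mul_mem' := fun hf hg => NL_mul hf hg
  add_mem' := fun hf hg => by
    have := NL_lin hf hg 1 1
    simp only [one_mul] at this
    exact this
  algebraMap_mem' := fun c => NL_const c

theorem NL_dense {p : ℕ} {r : ℝ} {L : ℕ}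
    (hsep : ∀ α β : Hty p r L, α ≠ β → ∃ f ∈ NL p r L, f α ≠ f β)
    (F : Hty p r L → ℝ) (hF : Continuous F) (ε : ℝ) (hε : 0 < ε) :
    ∃ f ∈ NL p r L, ∀ τ, |F τ - f τ| ≤ ε := by
  obtain ⟨g, hg⟩ :=
    ContinuousMap.exists_mem_subalgebra_near_continuous_of_separatesPoints (NLalg p r L)
    (by
      intro α β hne
      obtain ⟨f, hf, h⟩ := hsep α β hne
      exact ⟨f, ⟨⟨f, NL_continuous hf⟩, hf, rfl⟩, h⟩) F hF ε hε
  refine ⟨_, g.2, fun τ => ?_⟩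
  rw [abs_sub_comm]
  exact (hg τ).le

theorem NL_sep (p : ℕ) (r : ℝ) (L : ℕ) :
    ∀ α β : Hty p r L, α ≠ β → ∃ f ∈ NL p r L, f α ≠ f β := by
  induction L with
  | zero =>
    intro α β hne
    have h : toBall p r α ≠ toBall p r β := fun h => hne (Subtype.ext h)
    obtain ⟨i, hi⟩ : ∃ i, toBall p r α i ≠ toBall p r β i := by
      by_contra hcon
      push Not at hcon
      exact h (by ext i; exact hcon i)
    exact ⟨fun τ => toBall p r τ i, mem_NL_iff.2 ⟨_, _, vec1_lip.comp (coord_lip i), rfl⟩, hi⟩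
  | succ L ih =>
    intro α β hne
    by_cases h1 : projH p r L α = projH p r L β
    · have h2 : measOf p r L α ≠ measOf p r L β := by
        intro h2
        exact hne (Prod.ext h1 (Subtype.ext (Subtype.ext h2)))
      obtain ⟨F, hF⟩ : ∃ F : BoundedContinuousFunction (Hty p r L) ℝ,
          ∫ x, F x ∂(measOf p r L α) ≠ ∫ x, F x ∂(measOf p r L β) := by
        by_contra hcon
        push Not at hcon
        letI := TopologicalSpace.metrizableSpaceMetric (Hty p r L)
        exact h2 (ext_of_forall_integral_eq_of_IsFiniteMeasure hcon)
      have hmass : ∀ τ, (measOf p r L τ).real Set.univ ≤ 1 := by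
        intro τ
        have : (measOf p r L τ) Set.univ ≤ 1 := (toProd p r L τ).2.2
        exact ENNReal.toReal_le_of_le_ofReal zero_le_one (by simpa using this)
      set δ := |∫ x, F x ∂(measOf p r L α) - ∫ x, F x ∂(measOf p r L β)| with hδ
      have hδ0 : 0 < δ := abs_pos.2 (sub_ne_zero.2 hF)
      obtain ⟨f, hf, hfF⟩ := NL_dense ih F F.continuous (δ / 3) (by positivity)
      have hi : ∀ (G : Hty p r L → ℝ) (_ : Continuous G) τ, Integrable G (measOf p r L τ) :=
        fun G hG τ => hG.integrable_of_hasCompactSupport (HasCompactSupport.of_compactSpace _)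
      have hest : ∀ τ, |∫ x, F x ∂(measOf p r L τ) - ∫ x, f x ∂(measOf p r L τ)| ≤ δ / 3 := by
        intro τ
        rw [← integral_sub (hi F F.continuous τ) (hi f (NL_continuous hf) τ)]
        have := norm_integral_le_of_norm_le_const (μ := measOf p r L τ)
          (f := fun x => F x - f x) (C := δ / 3) (Filter.Eventually.of_forall hfF)
        refine this.trans ?_
        exact mul_le_of_le_one_right (by positivity) (hmass τ)
      refine ⟨fun τ => ∫ x, f x ∂(measOf p r L τ), ?_, ?_⟩
      · rw [mem_NL_iff] at hf ⊢
        refine ⟨1, _, hf, _, fun z => vec1 (z.2 0),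
          vec1_lip.comp ((coord_lip 0).comp LipschitzWith.prod_snd), ?_⟩
        funext τ
        congr 1
        exact ((EuclideanSpace.proj (𝕜 := ℝ) (0 : Fin 1)).integral_comp_comm
          (Hty_integrable hf.continuous (measOf p r L τ)))
      · intro heq
        have ha := abs_le.1 (hest α)
        have hb := abs_le.1 (hest β)
        simp only at heq
        have : δ ≤ 2 * (δ / 3) := by
          rw [hδ, abs_le]
          constructor <;> linarith [ha.1, ha.2, hb.1, hb.2]
        linarith
    · obtain ⟨f, hf, h⟩ := ih _ _ h1
      refine ⟨fun τ => f (projH p r L τ), ?_, h⟩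
      rw [mem_NL_iff] at hf ⊢
      exact ⟨1, _, hf, _, Prod.fst, LipschitzWith.prod_fst, rfl⟩

/-- The set `N¹_L` of MPNN feature maps on order-`L` iterated degree measures is closed
under multiplication and linear combinations, contains the constant function `1`, and
separates points of `H^L`; consequently it is uniformly dense in `C(H^L, ℝ)`. -/
theorem NL_subalgebra_dense (p L : ℕ) (r : ℝ) (hr : 0 < r) :
    (∀ f ∈ NL p r L, ∀ g ∈ NL p r L, (fun τ => f τ * g τ) ∈ NL p r L) ∧
    (∀ f ∈ NL p r L, ∀ g ∈ NL p r L, ∀ a b : ℝ,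
      (fun τ => a * f τ + b * g τ) ∈ NL p r L) ∧
    ((fun _ => (1 : ℝ)) ∈ NL p r L) ∧
    (∀ α β : Hty p r L, α ≠ β → ∃ f ∈ NL p r L, f α ≠ f β) ∧
    (∀ F : Hty p r L → ℝ, Continuous F → ∀ ε > 0,
      ∃ f ∈ NL p r L, ∀ τ, |F τ - f τ| ≤ ε) :=  by
  exact ⟨fun f hf g hg => NL_mul hf hg, fun f hf g hg a b => NL_lin hf hg a b, NL_const 1,
    NL_sep p r L, fun F hF ε hε => NL_dense (NL_sep p r L) F hF ε hε⟩
end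

section
/- Fix d > 0 and L ∈ ℕ. Let ν ∈ P(H^L) and (ν_i) be a sequence in P(H^L). Then ν_i → ν in the weak* topology if and only if H(φ,ψ,ν_i) → H(φ,ψ,ν) for every L-layer MPNN model φ with Lipschitz readout ψ: ℝ^{d_L} → ℝ^d, where H(φ,ψ,μ) = ψ(∫_{H^L} h(φ)^(L) dμ). -/
open MeasureTheory
open scoped ENNReal NNReal

open Filter
open scoped Topology

open BoundedContinuousFunction TopologicalSpace

namespace WS

/-- Sub-probability measures. -/
abbrev SubP (X : Type) [TopologicalSpace X] [MeasurableSpace X] [OpensMeasurableSpace X] : Type :=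
  {μ : FiniteMeasure X // (μ : Measure X) Set.univ ≤ 1}

/-- `H^{t+1}` is homeomorphic to the product. -/
def homeo (p : ℕ) (r : ℝ) (t : ℕ) : Hty p r (t + 1) ≃ₜ Hty p r t × SubP (Hty p r t) where
  toFun := fun τ => τ
  invFun := fun τ => τ
  left_inv := fun _ => rfl
  right_inv := fun _ => rfl
  continuous_toFun := continuous_id (X := Hty p r (t + 1))
  continuous_invFun := continuous_id (X := Hty p r (t + 1))

def homeo0 (p : ℕ) (r : ℝ) :
    Hty p r 0 ≃ₜ Metric.closedBall (0 : EuclideanSpace ℝ (Fin p)) r where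
  toFun := fun τ => τ
  invFun := fun τ => τ
  left_inv := fun _ => rfl
  right_inv := fun _ => rfl
  continuous_toFun := continuous_id (X := Hty p r 0)
  continuous_invFun := continuous_id (X := Hty p r 0)

section general
variable {X : Type} [TopologicalSpace X] [MeasurableSpace X] [BorelSpace X] [CompactSpace X]

theorem cont_integrable {n : ℕ} (u : X → EuclideanSpace ℝ (Fin n)) (hu : Continuous u)
    (μ : Measure X) [IsFiniteMeasure μ] : Integrable u μ := by
  obtain ⟨C, hC⟩ := (isCompact_range hu).isBounded.exists_norm_le
  refine Integrable.of_bound (C := C) hu.measurable.aestronglyMeasurable ?_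
  exact Filter.Eventually.of_forall fun x => hC _ ⟨x, rfl⟩

theorem cont_integrable' (u : X → ℝ) (hu : Continuous u)
    (μ : Measure X) [IsFiniteMeasure μ] : Integrable u μ := by
  obtain ⟨C, hC⟩ := (isCompact_range hu).isBounded.exists_norm_le
  refine Integrable.of_bound (C := C) hu.measurable.aestronglyMeasurable ?_
  exact Filter.Eventually.of_forall fun x => hC _ ⟨x, rfl⟩

/-- integration of vector valued continuous functions is weakly continuous -/
theorem continuous_integral_vec {n : ℕ} (u : X → EuclideanSpace ℝ (Fin n)) (hu : Continuous u) :
    Continuous (fun μ : FiniteMeasure X => ∫ x, u x ∂(μ : Measure X)) := by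
  rw [← (PiLp.homeomorph 2 (fun _ : Fin n => ℝ)).comp_continuous_iff]
  refine continuous_pi fun i => ?_
  have h : ∀ μ : FiniteMeasure X, (∫ x, u x ∂(μ : Measure X)) i = ∫ x, u x i ∂(μ : Measure X) := by
    intro μ
    exact ((EuclideanSpace.proj (𝕜 := ℝ) i).integral_comp_comm (cont_integrable u hu μ)).symm
  change Continuous (fun μ : FiniteMeasure X => (∫ x, u x ∂(μ : Measure X)) i)
  simp_rw [h]
  have hc : Continuous fun x => u x i := (EuclideanSpace.proj (𝕜 := ℝ) i).continuous.comp hu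
  rw [continuous_iff_continuousAt]
  intro μ
  exact FiniteMeasure.tendsto_iff_forall_integral_tendsto.1 (tendsto_id (α := FiniteMeasure X))
    (BoundedContinuousFunction.mkOfCompact ⟨_, hc⟩)

theorem integral_diff_le (μ : Measure X) [IsFiniteMeasure μ] (hm : μ Set.univ ≤ 1)
    (f g : X → ℝ) (hf : Continuous f) (hg : Continuous g) {ε : ℝ} (hε : 0 ≤ ε)
    (h : ∀ x, ‖f x - g x‖ ≤ ε) : |∫ x, f x ∂μ - ∫ x, g x ∂μ| ≤ ε := by
  rw [← integral_sub (cont_integrable' f hf μ) (cont_integrable' g hg μ), ← Real.norm_eq_abs]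
  refine (norm_integral_le_of_norm_le_const (Filter.Eventually.of_forall h)).trans ?_
  have : μ.real Set.univ ≤ 1 := ENNReal.toReal_le_of_le_ofReal zero_le_one (by simpa using hm)
  nlinarith

theorem dense_conv (A : Subalgebra ℝ C(X, ℝ)) (hA : A.SeparatesPoints)
    (μs : ℕ → Measure X) (μ : Measure X) [∀ i, IsFiniteMeasure (μs i)] [IsFiniteMeasure μ]
    (hm : ∀ i, μs i Set.univ ≤ 1) (hm' : μ Set.univ ≤ 1)
    (h : ∀ f ∈ A, Tendsto (fun i => ∫ x, f x ∂(μs i)) atTop (𝓝 (∫ x, f x ∂μ)))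
    (f : C(X, ℝ)) : Tendsto (fun i => ∫ x, f x ∂(μs i)) atTop (𝓝 (∫ x, f x ∂μ)) := by
  rw [Metric.tendsto_nhds]
  intro ε hε
  obtain ⟨g, hg⟩ := ContinuousMap.exists_mem_subalgebra_near_continuous_of_separatesPoints
    A hA f f.continuous (ε / 4) (by positivity)
  have h1 := Metric.tendsto_nhds.1 (h g g.2) (ε / 4) (by positivity)
  filter_upwards [h1] with i hi
  have a := integral_diff_le (μs i) (hm i) _ _ (g : C(X, ℝ)).continuous f.continuous
    (by positivity) (fun x => (hg x).le)
  have b := integral_diff_le μ hm' _ _ (g : C(X, ℝ)).continuous f.continuous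
    (by positivity) (fun x => (hg x).le)
  rw [Real.dist_eq, abs_lt] at *
  rw [abs_le] at a b
  constructor <;> linarith [a.1, a.2, b.1, b.2, hi.1, hi.2]

theorem meas_ext [T2Space X] [MetrizableSpace X] (μ ν : Measure X) [IsFiniteMeasure μ]
    [IsFiniteMeasure ν]
    (h : ∀ f : C(X, ℝ), ∫ x, f x ∂μ = ∫ x, f x ∂ν) : μ = ν :=
  ext_of_forall_integral_eq_of_IsFiniteMeasure fun f => h f.toContinuousMap

theorem meas_ext_alg [T2Space X] [MetrizableSpace X] (A : Subalgebra ℝ C(X, ℝ))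
    (hA : A.SeparatesPoints) (μ ν : Measure X) [IsFiniteMeasure μ]
    [IsFiniteMeasure ν] (hm : μ Set.univ ≤ 1) (hm' : ν Set.univ ≤ 1)
    (h : ∀ f ∈ A, ∫ x, f x ∂μ = ∫ x, f x ∂ν) : μ = ν := by
  refine meas_ext μ ν fun f => ?_
  have := dense_conv A hA (fun _ => μ) ν (fun _ => hm) hm'
    (fun f hf => by simp only [h f hf]; exact tendsto_const_nhds) f
  exact tendsto_nhds_unique tendsto_const_nhds this

theorem subP_compact [T2Space X] : CompactSpace (SubP X) := by
  have h := isCompact_setOfPred_finiteMeasure_le_of_compactSpace X 1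
  have h2 : {μ : FiniteMeasure X | μ.mass ≤ 1} =
      {μ : FiniteMeasure X | (μ : Measure X) Set.univ ≤ 1} := by
    ext μ
    simp only [Set.mem_ofPred_eq]
    rw [← FiniteMeasure.ennreal_mass]
    norm_cast
  rw [h2] at h
  exact isCompact_iff_compactSpace.1 h

theorem subP_metrizable [T2Space X] [MetrizableSpace X] : MetrizableSpace (SubP X) := by
  haveI : CompactSpace (SubP X) := subP_compact
  letI := metrizableSpaceMetric X
  let g : ℕ → C(X, ℝ) := denseSeq C(X, ℝ)
  have hg : DenseRange g := denseRange_denseSeq _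
  let F : SubP X → (ℕ → ℝ) := fun μ n => ∫ x, g n x ∂(μ.1 : Measure X)
  have hF : Continuous F := by
    refine continuous_pi fun n => ?_
    have : Continuous (fun μ : FiniteMeasure X => ∫ x, g n x ∂(μ : Measure X)) := by
      rw [continuous_iff_continuousAt]
      intro μ
      exact FiniteMeasure.tendsto_iff_forall_integral_tendsto.1
        (tendsto_id (α := FiniteMeasure X)) (BoundedContinuousFunction.mkOfCompact (g n))
    exact this.comp continuous_subtype_val
  have hI : Function.Injective F := by
    intro μ ν h
    apply Subtype.ext
    apply FiniteMeasure.toMeasure_injective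
    refine meas_ext _ _ fun f => ?_
    by_contra hne
    have hpos : 0 < |∫ x, f x ∂(μ.1 : Measure X) - ∫ x, f x ∂(ν.1 : Measure X)| :=
      abs_pos.2 (sub_ne_zero.2 hne)
    set δ := |∫ x, f x ∂(μ.1 : Measure X) - ∫ x, f x ∂(ν.1 : Measure X)| with hδ
    obtain ⟨n, hn⟩ := hg.exists_dist_lt f (ε := δ / 4) (by positivity)
    have hx : ∀ x, ‖f x - g n x‖ ≤ δ / 4 := fun x => by
      rw [← dist_eq_norm]
      exact (ContinuousMap.dist_apply_le_dist x).trans hn.le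
    have a := integral_diff_le (μ.1 : Measure X) μ.2 _ _ f.continuous (g n).continuous
      (by positivity) hx
    have b := integral_diff_le (ν.1 : Measure X) ν.2 _ _ f.continuous (g n).continuous
      (by positivity) hx
    have c : ∫ x, g n x ∂(μ.1 : Measure X) = ∫ x, g n x ∂(ν.1 : Measure X) := congrFun h n
    rw [c] at a
    have : δ ≤ δ / 4 + δ / 4 := by
      rw [hδ] at *
      rw [abs_le] at a b ⊢
      constructor <;> linarith [a.1, a.2, b.1, b.2]
    linarith
  exact (hF.isClosedEmbedding hI).isEmbedding.metrizableSpace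

end general

theorem hty_top (p : ℕ) (r : ℝ) (t : ℕ) :
    CompactSpace (Hty p r t) ∧ T2Space (Hty p r t) ∧ MetrizableSpace (Hty p r t) := by
  induction t with
  | zero =>
    haveI : CompactSpace (Metric.closedBall (0 : EuclideanSpace ℝ (Fin p)) r) :=
      isCompact_iff_compactSpace.1 (isCompact_closedBall _ _)
    exact ⟨(homeo0 p r).symm.compactSpace, (homeo0 p r).symm.t2Space,
      (homeo0 p r).isEmbedding.metrizableSpace⟩
  | succ t ih =>
    obtain ⟨h1, h2, h3⟩ := ih
    haveI := subP_compact (X := Hty p r t)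
    haveI := subP_metrizable (X := Hty p r t)
    exact ⟨(homeo p r t).symm.compactSpace, (homeo p r t).symm.t2Space,
      (homeo p r t).isEmbedding.metrizableSpace⟩

instance (p : ℕ) (r : ℝ) (t : ℕ) : CompactSpace (Hty p r t) := (hty_top p r t).1
instance (p : ℕ) (r : ℝ) (t : ℕ) : T2Space (Hty p r t) := (hty_top p r t).2.1
instance (p : ℕ) (r : ℝ) (t : ℕ) : MetrizableSpace (Hty p r t) := (hty_top p r t).2.2

theorem projH_cont (p : ℕ) (r : ℝ) (t : ℕ) : Continuous (projH p r t) := by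
  have h : Continuous (fun τ => (homeo p r t τ).1) :=
    continuous_fst.comp (homeo p r t).continuous
  exact h

/-- measure part -/
noncomputable def mpart (p : ℕ) (r : ℝ) (t : ℕ) (τ : Hty p r (t + 1)) : FiniteMeasure (Hty p r t) :=
  (homeo p r t τ).2.1

theorem mpart_cont (p : ℕ) (r : ℝ) (t : ℕ) : Continuous (mpart p r t) :=
  continuous_subtype_val.comp (continuous_snd.comp (homeo p r t).continuous)

theorem measOf_eq (p : ℕ) (r : ℝ) (t : ℕ) (τ : Hty p r (t + 1)) :
    measOf p r t τ = (mpart p r t τ : Measure (Hty p r t)) := rfl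

instance (p : ℕ) (r : ℝ) (t : ℕ) (τ : Hty p r (t + 1)) : IsFiniteMeasure (measOf p r t τ) := by
  rw [measOf_eq]; infer_instance

theorem measOf_le (p : ℕ) (r : ℝ) (t : ℕ) (τ : Hty p r (t + 1)) :
    measOf p r t τ Set.univ ≤ 1 := (homeo p r t τ).2.2

theorem feat_cont (p : ℕ) (r : ℝ) (Φ : MPNN p) (t : ℕ) : Continuous (feat p r Φ t) := by
  induction t with
  | zero => exact Φ.lip0.continuous.comp (continuous_subtype_val.comp (homeo0 p r).continuous)
  | succ t ih =>
    have h2 := (continuous_integral_vec _ ih).comp (mpart_cont p r t)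
    exact (Φ.lip t).continuous.comp ((ih.comp (projH_cont p r t)).prodMk h2)

/-- constant width models -/
structure CM (p N : ℕ) where
  φ0 : EuclideanSpace ℝ (Fin p) → EuclideanSpace ℝ (Fin N)
  φ : ℕ → EuclideanSpace ℝ (Fin N) × EuclideanSpace ℝ (Fin N) → EuclideanSpace ℝ (Fin N)
  lip0 : ∃ K, LipschitzWith K φ0
  lip : ∀ t, ∃ K, LipschitzWith K (φ t)

noncomputable def CM.toMPNN {p N : ℕ} (M : CM p N) : MPNN p where
  dims := fun _ => N
  K0 := M.lip0.choose
  Ks := fun t => (M.lip t).choose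
  φ0 := M.φ0
  φ := M.φ
  lip0 := M.lip0.choose_spec
  lip := fun t => (M.lip t).choose_spec

noncomputable def CM.f {p N : ℕ} (M : CM p N) (r : ℝ) (t : ℕ) :
    Hty p r t → EuclideanSpace ℝ (Fin N) := feat p r M.toMPNN t

theorem CM.f_zero {p N : ℕ} (M : CM p N) (r : ℝ) (τ : Hty p r 0) :
    M.f r 0 τ = M.φ0 (toBall p r τ) := rfl

theorem CM.f_succ {p N : ℕ} (M : CM p N) (r : ℝ) (t : ℕ) (τ : Hty p r (t + 1)) :
    M.f r (t + 1) τ = M.φ t (M.f r t (projH p r t τ), ∫ x, M.f r t x ∂(measOf p r t τ)) := rfl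

theorem CM.f_cont {p N : ℕ} (M : CM p N) (r : ℝ) (t : ℕ) : Continuous (M.f r t) :=
  feat_cont p r M.toMPNN t

theorem CM.f_int {p N : ℕ} (M : CM p N) (r : ℝ) (t : ℕ) (μ : Measure (Hty p r t))
    [IsFiniteMeasure μ] : Integrable (M.f r t) μ := cont_integrable _ (M.f_cont r t) μ

theorem CM.f_congr {p N : ℕ} (M M' : CM p N) (r : ℝ) (t : ℕ) (h0 : M.φ0 = M'.φ0)
    (h : ∀ s < t, M.φ s = M'.φ s) : M.f r t = M'.f r t := by
  induction t with
  | zero => funext τ; rw [CM.f_zero, CM.f_zero, h0]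
  | succ t ih =>
    funext τ
    rw [CM.f_succ, CM.f_succ, ih fun s hs => h s (by omega), h t (by omega)]

section lip
variable {α β γ : Type*} [PseudoEMetricSpace α] [PseudoEMetricSpace β] [PseudoEMetricSpace γ]

def Lip (f : α → β) : Prop := ∃ K, LipschitzWith K f

theorem Lip.comp {g : β → γ} {f : α → β} (hg : Lip g) (hf : Lip f) : Lip (fun x => g (f x)) := by
  obtain ⟨a, ha⟩ := hg
  obtain ⟨b, hb⟩ := hf
  exact ⟨_, ha.comp hb⟩

theorem Lip.pair {g : α → γ} {f : α → β} (hf : Lip f) (hg : Lip g) :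
    Lip (fun x => (f x, g x)) := by
  obtain ⟨a, ha⟩ := hg
  obtain ⟨b, hb⟩ := hf
  exact ⟨_, hb.prodMk ha⟩

theorem Lip.fst : Lip (Prod.fst : α × β → α) := ⟨_, LipschitzWith.prod_fst⟩
theorem Lip.snd : Lip (Prod.snd : α × β → β) := ⟨_, LipschitzWith.prod_snd⟩
theorem Lip.id : Lip (fun x : α => x) := ⟨_, LipschitzWith.id⟩
theorem Lip.cst (b : β) : Lip (fun _ : α => b) := ⟨_, LipschitzWith.const b⟩
end lip

/-- replace the update function at step `t` by a linear map -/
noncomputable def CM.upd {p N : ℕ} (M : CM p N) (t : ℕ)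
    (G : EuclideanSpace ℝ (Fin N) × EuclideanSpace ℝ (Fin N) → EuclideanSpace ℝ (Fin N))
    (hG : Lip G) : CM p N where
  φ0 := M.φ0
  φ := fun s => if s = t then G else M.φ s
  lip0 := M.lip0
  lip := fun s => by
    by_cases hs : s = t
    · simpa [hs, Lip] using hG
    · simpa [hs] using M.lip s

theorem CM.upd_f {p N : ℕ} (M : CM p N) (r : ℝ) (t : ℕ)
    (G : EuclideanSpace ℝ (Fin N) × EuclideanSpace ℝ (Fin N) → EuclideanSpace ℝ (Fin N))
    (hG : Lip G) (τ : Hty p r (t + 1)) :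
    (M.upd t G hG).f r (t + 1) τ =
      G (M.f r t (projH p r t τ), ∫ x, M.f r t x ∂(measOf p r t τ)) := by
  rw [CM.f_succ, CM.f_congr (M.upd t G hG) M r t rfl]
  · simp [CM.upd]
  · intro s hs
    simp [CM.upd, hs.ne]

noncomputable def eqv (a b : ℕ) : EuclideanSpace ℝ (Fin (a + b)) ≃L[ℝ]
    EuclideanSpace ℝ (Fin a) × EuclideanSpace ℝ (Fin b) :=
  ContinuousLinearEquiv.ofFinrankEq (by simp)

noncomputable def eqv1 (a : ℕ) : EuclideanSpace ℝ (Fin (a + 1)) ≃L[ℝ]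
    EuclideanSpace ℝ (Fin a) × ℝ :=
  ContinuousLinearEquiv.ofFinrankEq (by simp)

theorem Lip.clm {E F : Type*} [NormedAddCommGroup E] [NormedSpace ℝ E] [NormedAddCommGroup F]
    [NormedSpace ℝ F] (T : E →L[ℝ] F) : Lip (fun x => T x) := ⟨_, T.lipschitz⟩

noncomputable def CM.pr {p a b : ℕ} (M : CM p a) (M' : CM p b) : CM p (a + b) where
  φ0 := fun z => (eqv a b).symm (M.φ0 z, M'.φ0 z)
  φ := fun t q => (eqv a b).symm (M.φ t ((eqv a b q.1).1, (eqv a b q.2).1),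
    M'.φ t ((eqv a b q.1).2, (eqv a b q.2).2))
  lip0 := (Lip.clm (eqv a b).symm.toContinuousLinearMap).comp (Lip.pair M.lip0 M'.lip0)
  lip := fun t => by
    have e1 : Lip (fun q => eqv a b q) := Lip.clm (eqv a b).toContinuousLinearMap
    refine (Lip.clm (eqv a b).symm.toContinuousLinearMap).comp (Lip.pair ?_ ?_)
    · exact Lip.comp (M.lip t) (Lip.pair (Lip.fst.comp (e1.comp Lip.fst))
        (Lip.fst.comp (e1.comp Lip.snd)))
    · exact Lip.comp (M'.lip t) (Lip.pair (Lip.snd.comp (e1.comp Lip.fst))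
        (Lip.snd.comp (e1.comp Lip.snd)))

theorem CM.pr_f {p a b : ℕ} (M : CM p a) (M' : CM p b) (r : ℝ) (t : ℕ) (τ : Hty p r t) :
    (M.pr M').f r t τ = (eqv a b).symm (M.f r t τ, M'.f r t τ) := by
  induction t with
  | zero => rfl
  | succ t ih =>
    have hI : eqv a b (∫ x, (M.pr M').f r t x ∂(measOf p r t τ)) =
        (∫ x, M.f r t x ∂(measOf p r t τ), ∫ x, M'.f r t x ∂(measOf p r t τ)) := by
      rw [← (eqv a b).integral_comp_comm]
      simp_rw [ih, ContinuousLinearEquiv.apply_symm_apply]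
      exact integral_pair (M.f_int r t _) (M'.f_int r t _)
    rw [CM.f_succ]
    simp only [CM.pr] at hI ⊢
    rw [hI]
    have := ih (projH p r t τ)
    simp only [CM.pr] at this
    rw [this, ContinuousLinearEquiv.apply_symm_apply]
    rfl

/-- adjoin a readout as an extra coordinate -/
noncomputable def CM.ext {p a : ℕ} (M : CM p a) (g : EuclideanSpace ℝ (Fin a) → ℝ)
    (hg : Lip g) : CM p (a + 1) where
  φ0 := fun z => (eqv1 a).symm (M.φ0 z, g (M.φ0 z))
  φ := fun t q => (eqv1 a).symm (M.φ t ((eqv1 a q.1).1, (eqv1 a q.2).1),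
    g (M.φ t ((eqv1 a q.1).1, (eqv1 a q.2).1)))
  lip0 := (Lip.clm (eqv1 a).symm.toContinuousLinearMap).comp (Lip.pair M.lip0 (hg.comp M.lip0))
  lip := fun t => by
    have e1 : Lip (fun q => eqv1 a q) := Lip.clm (eqv1 a).toContinuousLinearMap
    have e2 := Lip.comp (M.lip t) (Lip.pair (Lip.fst.comp (e1.comp Lip.fst))
        (Lip.fst.comp (e1.comp Lip.snd)))
    exact (Lip.clm (eqv1 a).symm.toContinuousLinearMap).comp (Lip.pair e2 (hg.comp e2))

theorem CM.ext_f {p a : ℕ} (M : CM p a) (g : EuclideanSpace ℝ (Fin a) → ℝ)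
    (hg : Lip g) (r : ℝ) (t : ℕ) (τ : Hty p r t) :
    (M.ext g hg).f r t τ = (eqv1 a).symm (M.f r t τ, g (M.f r t τ)) := by
  induction t with
  | zero => rfl
  | succ t ih =>
    have hgc : Continuous g := hg.choose_spec.continuous
    have hI : eqv1 a (∫ x, (M.ext g hg).f r t x ∂(measOf p r t τ)) =
        (∫ x, M.f r t x ∂(measOf p r t τ), ∫ x, g (M.f r t x) ∂(measOf p r t τ)) := by
      rw [← (eqv1 a).integral_comp_comm]
      simp_rw [ih, ContinuousLinearEquiv.apply_symm_apply]
      exact integral_pair (M.f_int r t _) (cont_integrable' _ (hgc.comp (M.f_cont r t)) _)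
    rw [CM.f_succ]
    simp only [CM.ext] at hI ⊢
    rw [hI]
    have := ih (projH p r t τ)
    simp only [CM.ext] at this
    rw [this, ContinuousLinearEquiv.apply_symm_apply]
    rfl

theorem CM.ext_int {p a : ℕ} (M : CM p a) (g : EuclideanSpace ℝ (Fin a) → ℝ)
    (hg : Lip g) (r : ℝ) (t : ℕ) (μ : Measure (Hty p r t)) [IsFiniteMeasure μ] :
    (eqv1 a (∫ x, (M.ext g hg).f r t x ∂μ)).2 = ∫ x, g (M.f r t x) ∂μ := by
  have hgc : Continuous g := hg.choose_spec.continuous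
  rw [← (eqv1 a).integral_comp_comm]
  simp_rw [CM.ext_f, ContinuousLinearEquiv.apply_symm_apply]
  have hi : Integrable (fun x => g (M.f r t x)) μ :=
    cont_integrable' _ (hgc.comp (M.f_cont r t)) _
  rw [integral_pair (M.f_int r t _) hi]

/-- scalar functions realised by an MPNN with Lipschitz readout -/
def S (p : ℕ) (r : ℝ) (t : ℕ) (f : Hty p r t → ℝ) : Prop :=
  ∃ (N : ℕ) (M : CM p N) (g : EuclideanSpace ℝ (Fin N) → ℝ), Lip g ∧ ∀ τ, f τ = g (M.f r t τ)

theorem S.comp2 {p : ℕ} {r : ℝ} {t : ℕ} {f f' : Hty p r t → ℝ} (hf : S p r t f)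
    (hf' : S p r t f') (G : ℝ × ℝ → ℝ) (hG : Lip G) : S p r t (fun τ => G (f τ, f' τ)) := by
  obtain ⟨a, M, g, hg, h⟩ := hf
  obtain ⟨b, M', g', hg', h'⟩ := hf'
  have e1 : Lip (fun q => eqv a b q) := Lip.clm (eqv a b).toContinuousLinearMap
  refine ⟨a + b, M.pr M', fun x => G (g (eqv a b x).1, g' (eqv a b x).2),
    hG.comp (Lip.pair (hg.comp (Lip.fst.comp e1)) (hg'.comp (Lip.snd.comp e1))), fun τ => ?_⟩
  beta_reduce
  rw [CM.pr_f, ContinuousLinearEquiv.apply_symm_apply, h, h']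

theorem S.const {p : ℕ} {r : ℝ} {t : ℕ} (c : ℝ) : S p r t (fun _ => c) :=
  ⟨0, ⟨fun _ => 0, fun _ _ => 0, Lip.cst _, fun _ => Lip.cst _⟩, fun _ => c, Lip.cst _,
    fun _ => rfl⟩

theorem S.add {p : ℕ} {r : ℝ} {t : ℕ} {f f' : Hty p r t → ℝ} (hf : S p r t f)
    (hf' : S p r t f') : S p r t (fun τ => f τ + f' τ) :=
  hf.comp2 hf' (fun q => q.1 + q.2)
    (Lip.clm (ContinuousLinearMap.fst ℝ ℝ ℝ + ContinuousLinearMap.snd ℝ ℝ ℝ))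

theorem S.cont {p : ℕ} {r : ℝ} {t : ℕ} {f : Hty p r t → ℝ} (hf : S p r t f) : Continuous f := by
  obtain ⟨a, M, g, ⟨K, hg⟩, h⟩ := hf
  rw [show f = fun τ => g (M.f r t τ) from funext h]
  exact hg.continuous.comp (M.f_cont r t)

theorem clamp_mul_lip (C : ℝ) (hC : 0 ≤ C) :
    Lip (fun q : ℝ × ℝ => max (-C) (min C q.1) * max (-C) (min C q.2)) := by
  have hb : ∀ x : ℝ, |max (-C) (min C x)| ≤ C := fun x =>
    abs_le.2 ⟨le_max_left _ _, max_le (by linarith) (min_le_left _ _)⟩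
  have hl : ∀ x y : ℝ, |max (-C) (min C x) - max (-C) (min C y)| ≤ |x - y| := fun x y =>
    ((abs_max_sub_max_le_max (-C) (min C x) (-C) (min C y)).trans (by simp)).trans
      ((abs_min_sub_min_le_max C x C y).trans (by simp))
  refine ⟨⟨2 * C, by positivity⟩, LipschitzWith.of_dist_le_mul fun x y => ?_⟩
  rw [Real.dist_eq, Prod.dist_eq, Real.dist_eq, Real.dist_eq]
  set a := max (-C) (min C x.1)
  set b := max (-C) (min C x.2)
  set a' := max (-C) (min C y.1)
  set b' := max (-C) (min C y.2)
  have h1 : |a - a'| ≤ max |x.1 - y.1| |x.2 - y.2| := (hl _ _).trans (le_max_left _ _)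
  have h2 : |b - b'| ≤ max |x.1 - y.1| |x.2 - y.2| := (hl _ _).trans (le_max_right _ _)
  calc |a * b - a' * b'| = |a * (b - b') + (a - a') * b'| := by ring_nf
    _ ≤ |a| * |b - b'| + |a - a'| * |b'| := by
        rw [← abs_mul, ← abs_mul]; exact abs_add_le _ _
    _ ≤ C * max |x.1 - y.1| |x.2 - y.2| + max |x.1 - y.1| |x.2 - y.2| * C := by
        gcongr
        · exact hb _
        · exact hb _
    _ = (2 * C) * max |x.1 - y.1| |x.2 - y.2| := by ring

theorem S.mul {p : ℕ} {r : ℝ} {t : ℕ} {f f' : Hty p r t → ℝ} (hf : S p r t f)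
    (hf' : S p r t f') : S p r t (fun τ => f τ * f' τ) := by
  obtain ⟨C, hC⟩ := (isCompact_range hf.cont).isBounded.exists_norm_le
  obtain ⟨C', hC'⟩ := (isCompact_range hf'.cont).isBounded.exists_norm_le
  set D := max 0 (max C C')
  have h := hf.comp2 hf' _ (clamp_mul_lip D (le_max_left _ _))
  convert h using 2 with τ
  have h1 : |f τ| ≤ D := (hC _ ⟨τ, rfl⟩).trans ((le_max_left _ _).trans (le_max_right _ _))
  have h2 : |f' τ| ≤ D := (hC' _ ⟨τ, rfl⟩).trans ((le_max_right _ _).trans (le_max_right _ _))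
  rw [abs_le] at h1 h2
  simp only
  rw [min_eq_right h1.2, min_eq_right h2.2, max_eq_right h1.1, max_eq_right h2.1]

theorem S.proj {p : ℕ} {r : ℝ} {t : ℕ} {f : Hty p r t → ℝ} (hf : S p r t f) :
    S p r (t + 1) (fun τ => f (projH p r t τ)) := by
  obtain ⟨a, M, g, hg, h⟩ := hf
  refine ⟨a, M.upd t Prod.fst Lip.fst, g, hg, fun τ => ?_⟩
  beta_reduce
  rw [CM.upd_f, h]

theorem S.integ {p : ℕ} {r : ℝ} {t : ℕ} {f : Hty p r t → ℝ} (hf : S p r t f) :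
    S p r (t + 1) (fun τ => ∫ x, f x ∂(measOf p r t τ)) := by
  obtain ⟨a, M, g, hg, h⟩ := hf
  have e1 : Lip (fun q => eqv1 a q) := Lip.clm (eqv1 a).toContinuousLinearMap
  refine ⟨a + 1, (M.ext g hg).upd t Prod.snd Lip.snd, fun x => (eqv1 a x).2,
    Lip.snd.comp e1, fun τ => ?_⟩
  beta_reduce
  rw [CM.upd_f, CM.ext_int]
  simp_rw [h]

/-- the algebra of realisable functions -/
def alg (p : ℕ) (r : ℝ) (t : ℕ) : Subalgebra ℝ C(Hty p r t, ℝ) where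
  carrier := {f | S p r t f}
  mul_mem' := fun ha hb => S.mul ha hb
  add_mem' := fun ha hb => S.add ha hb
  algebraMap_mem' := fun c => S.const c

theorem alg_sep (p : ℕ) (r : ℝ) (t : ℕ) : (alg p r t).SeparatesPoints := by
  induction t with
  | zero =>
    intro x y hxy
    have hne : toBall p r x ≠ toBall p r y := fun h => hxy (Subtype.ext h)
    have : ∃ i, toBall p r x i ≠ toBall p r y i := by
      by_contra hcon
      push Not at hcon
      exact hne (PiLp.ext hcon)
    obtain ⟨i, hi⟩ := this
    have hS : S p r 0 (fun τ => toBall p r τ i) :=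
      ⟨p, ⟨fun z => z, fun _ _ => 0, Lip.id, fun _ => Lip.cst _⟩, fun z => z i,
        Lip.clm (EuclideanSpace.proj (𝕜 := ℝ) i), fun _ => rfl⟩
    exact ⟨_, ⟨⟨_, hS.cont⟩, hS, rfl⟩, hi⟩
  | succ t ih =>
    intro x y hxy
    by_cases h1 : projH p r t x = projH p r t y
    · by_contra hcon
      have hall : ∀ f : Hty p r (t + 1) → ℝ, S p r (t + 1) f → f x = f y := by
        intro f hf
        by_contra hne
        exact hcon ⟨_, ⟨⟨f, hf.cont⟩, hf, rfl⟩, hne⟩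
      have hm : measOf p r t x = measOf p r t y := by
        refine meas_ext_alg (alg p r t) ih _ _ (measOf_le p r t x) (measOf_le p r t y) ?_
        intro f hf
        exact hall _ (S.integ hf)
      apply hxy
      apply (homeo p r t).injective
      refine Prod.ext h1 (Subtype.ext (FiniteMeasure.toMeasure_injective hm))
    · obtain ⟨_, ⟨f, hf, rfl⟩, hne⟩ := ih h1
      have hS := S.proj hf
      exact ⟨_, ⟨⟨_, hS.cont⟩, hS, rfl⟩, hne⟩

end WS

/-- Weak* convergence of distributions of iterated degree measures is equivalent to
convergence of the outputs of all MPNN models with Lipschitz readout: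
`ν_i → ν` in the weak* topology iff `H(φ,ψ,ν_i) → H(φ,ψ,ν)` for every `L`-layer MPNN
model `φ` with Lipschitz readout `ψ : ℝ^{d_L} → ℝ^d`. -/
theorem weakStar_iff_mpnn_outputs (p L dout : ℕ) (hd : 0 < dout) (r : ℝ) (hr : 0 < r)
    (ν : ProbabilityMeasure (Hty p r L)) (νs : ℕ → ProbabilityMeasure (Hty p r L)) :
    Tendsto νs atTop (𝓝 ν) ↔
      ∀ (Φ : MPNN p)
        (ψ : EuclideanSpace ℝ (Fin (Φ.dims L)) → EuclideanSpace ℝ (Fin dout))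
        (K : ℝ≥0), LipschitzWith K ψ →
        Tendsto (fun i => ψ (∫ x, feat p r Φ L x ∂(νs i : Measure (Hty p r L))))
          atTop (𝓝 (ψ (∫ x, feat p r Φ L x ∂(ν : Measure (Hty p r L))))) := by
  classical
  constructor
  · intro h Φ ψ K hψ
    have h1 := ((ProbabilityMeasure.toFiniteMeasure_isEmbedding (Hty p r L)).continuous.tendsto ν).comp h
    exact (hψ.continuous.tendsto _).comp
      (((WS.continuous_integral_vec _ (WS.feat_cont p r Φ L)).tendsto _).comp h1)
  · intro h
    rw [ProbabilityMeasure.tendsto_iff_forall_integral_tendsto]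
    intro f
    refine WS.dense_conv (WS.alg p r L) (WS.alg_sep p r L)
      (fun i => (νs i : Measure (Hty p r L))) (ν : Measure (Hty p r L))
      (fun i => prob_le_one) prob_le_one ?_ f.toContinuousMap
    intro g hg
    obtain ⟨a, M, k, hk, hgk⟩ := hg
    let v : EuclideanSpace ℝ (Fin dout) := EuclideanSpace.single ⟨0, hd⟩ 1
    let T : EuclideanSpace ℝ (Fin (a + 1)) →L[ℝ] EuclideanSpace ℝ (Fin dout) :=
      ((ContinuousLinearMap.snd ℝ _ ℝ).comp (WS.eqv1 a).toContinuousLinearMap).smulRight v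
    have key : ∀ μ : ProbabilityMeasure (Hty p r L),
        (T (∫ x, (M.ext k hk).f r L x ∂(μ : Measure (Hty p r L)))) ⟨0, hd⟩ =
          ∫ x, g x ∂(μ : Measure (Hty p r L)) := by
      intro μ
      have h2 := WS.CM.ext_int M k hk r L (μ : Measure (Hty p r L))
      have h3 : ∀ z, (T z) ⟨0, hd⟩ = (WS.eqv1 a z).2 := by
        intro z
        simp [T, v]
      rw [h3, h2]
      exact integral_congr_ae (Filter.Eventually.of_forall fun x => (hgk x).symm)
    have h4 := h (M.ext k hk).toMPNN T _ T.lipschitz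
    have h5 := ((EuclideanSpace.proj (𝕜 := ℝ) (⟨0, hd⟩ : Fin dout)).continuous.tendsto _).comp h4
    have h6 : Tendsto (fun i =>
        (T (∫ x, (M.ext k hk).f r L x ∂(νs i : Measure (Hty p r L)))) ⟨0, hd⟩) atTop
        (𝓝 ((T (∫ x, (M.ext k hk).f r L x ∂(ν : Measure (Hty p r L)))) ⟨0, hd⟩)) := h5
    simp_rw [key] at h6
    exact h6
end
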